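/- Master symmetry relations: let Δ be the vector field Δf = ((J₁² + 4J₂²)/2)·∂f/∂J₁ + J₁J₂·∂f/∂J₂ and for i = 0,1,2,3 let Xᵢ be the vector field Xᵢ f = (mk²/(J₁+2J₂)^{3−i})·(∂f/∂φ¹ + 2·∂f/∂φ²). Then (a) for each i ∈ {0,1,2}, the commutator of Xᵢ with the rescaled field Δᵢ₊₁ = (2/(3−i))·Δ equals X_{i+1}; that is, for every twice continuously differentiable f and every point with J₁ + 2J₂ ≠ 0, Xᵢ(Δᵢ₊₁ f) − Δᵢ₊₁(Xᵢ f) = X_{i+1} f; and (b) Δ applied to H₀ = −mk²/(2(J₁+2J₂)²) gives Δ(H₀) = mk²/(2(J₁+2J₂)), which is a first integral of H₀ for the canonical bracket: {H₀, Δ(H₀)} = 0. -/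

import Mathlib

noncomputable section

/-- Partial derivative with respect to the action coordinate `J₁`. -/
def pdJ1 (f : ℝ → ℝ → ℝ → ℝ → ℝ) (J1 J2 φ1 φ2 : ℝ) : ℝ :=
  deriv (fun x => f x J2 φ1 φ2) J1

/-- Partial derivative with respect to the action coordinate `J₂`. -/
def pdJ2 (f : ℝ → ℝ → ℝ → ℝ → ℝ) (J1 J2 φ1 φ2 : ℝ) : ℝ :=
  deriv (fun x => f J1 x φ1 φ2) J2

/-- Partial derivative with respect to the angle coordinate `φ¹`. -/
def pdA1 (f : ℝ → ℝ → ℝ → ℝ → ℝ) (J1 J2 φ1 φ2 : ℝ) : ℝ :=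
  deriv (fun x => f J1 J2 x φ2) φ1

/-- Partial derivative with respect to the angle coordinate `φ²`. -/
def pdA2 (f : ℝ → ℝ → ℝ → ℝ → ℝ) (J1 J2 φ1 φ2 : ℝ) : ℝ :=
  deriv (fun x => f J1 J2 φ1 x) φ2

/-- The canonical Poisson bracket in action-angle coordinates:
`{f,g} = Σₕ (∂f/∂Jₕ ∂g/∂φʰ - ∂f/∂φʰ ∂g/∂Jₕ)`. -/
def aaPB (f g : ℝ → ℝ → ℝ → ℝ → ℝ) (J1 J2 φ1 φ2 : ℝ) : ℝ :=
  (pdJ1 f J1 J2 φ1 φ2 * pdA1 g J1 J2 φ1 φ2 - pdA1 f J1 J2 φ1 φ2 * pdJ1 g J1 J2 φ1 φ2) +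
  (pdJ2 f J1 J2 φ1 φ2 * pdA2 g J1 J2 φ1 φ2 - pdA2 f J1 J2 φ1 φ2 * pdJ2 g J1 J2 φ1 φ2)

/-- The second Poisson bracket, with coefficient matrix
`C = (1/((J₁-2J₂)(J₁+2J₂)))·[[J₁, -4J₂], [-J₂, J₁]]`:
`{f,g}₁ = Σₕₗ Cₕₗ (∂f/∂Jₕ ∂g/∂φˡ - ∂f/∂φˡ ∂g/∂Jₕ)`. -/
def aaPB1 (f g : ℝ → ℝ → ℝ → ℝ → ℝ) (J1 J2 φ1 φ2 : ℝ) : ℝ :=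
  J1 / ((J1 - 2 * J2) * (J1 + 2 * J2)) *
    (pdJ1 f J1 J2 φ1 φ2 * pdA1 g J1 J2 φ1 φ2 - pdA1 f J1 J2 φ1 φ2 * pdJ1 g J1 J2 φ1 φ2) +
  -(4 * J2) / ((J1 - 2 * J2) * (J1 + 2 * J2)) *
    (pdJ1 f J1 J2 φ1 φ2 * pdA2 g J1 J2 φ1 φ2 - pdA2 f J1 J2 φ1 φ2 * pdJ1 g J1 J2 φ1 φ2) +
  -J2 / ((J1 - 2 * J2) * (J1 + 2 * J2)) *
    (pdJ2 f J1 J2 φ1 φ2 * pdA1 g J1 J2 φ1 φ2 - pdA1 f J1 J2 φ1 φ2 * pdJ2 g J1 J2 φ1 φ2) +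
  J1 / ((J1 - 2 * J2) * (J1 + 2 * J2)) *
    (pdJ2 f J1 J2 φ1 φ2 * pdA2 g J1 J2 φ1 φ2 - pdA2 f J1 J2 φ1 φ2 * pdJ2 g J1 J2 φ1 φ2)

/-- The hierarchy of Hamiltonians `H₀,…,H₃` of the Kepler problem in
action-angle coordinates. -/
def aaH (m k : ℝ) : ℕ → ℝ → ℝ → ℝ → ℝ → ℝ
  | 0 => fun J1 J2 _ _ => -(m * k ^ 2) / (2 * (J1 + 2 * J2) ^ 2)
  | 1 => fun J1 J2 _ _ => -(m * k ^ 2) / (J1 + 2 * J2)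
  | 2 => fun J1 J2 _ _ => m * k ^ 2 * Real.log (J1 + 2 * J2)
  | _ => fun J1 J2 _ _ => m * k ^ 2 * (J1 + 2 * J2)

/-- The hierarchy of vector fields
`Xᵢ f = (mk²/(J₁+2J₂)^{3-i})·(∂f/∂φ¹ + 2∂f/∂φ²)`. -/
def aaX (m k : ℝ) (i : ℕ) (f : ℝ → ℝ → ℝ → ℝ → ℝ) (J1 J2 φ1 φ2 : ℝ) : ℝ :=
  m * k ^ 2 / (J1 + 2 * J2) ^ (3 - i) *
    (pdA1 f J1 J2 φ1 φ2 + 2 * pdA2 f J1 J2 φ1 φ2)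

/-- The master-symmetry vector field
`Δf = ((J₁² + 4J₂²)/2)·∂f/∂J₁ + J₁J₂·∂f/∂J₂`. -/
def aaDelta (f : ℝ → ℝ → ℝ → ℝ → ℝ) (J1 J2 φ1 φ2 : ℝ) : ℝ :=
  (J1 ^ 2 + 4 * J2 ^ 2) / 2 * pdJ1 f J1 J2 φ1 φ2 + J1 * J2 * pdJ2 f J1 J2 φ1 φ2

/-- A function of four real variables, viewed as a function on the product space. -/
def uncurryFour (f : ℝ → ℝ → ℝ → ℝ → ℝ) (z : ℝ × ℝ × ℝ × ℝ) : ℝ :=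
  f z.1 z.2.1 z.2.2.1 z.2.2.2

section Partials

variable {p : ℝ → ℝ → ℝ → ℝ → ℝ} {P : ℝ × ℝ × ℝ × ℝ → ℝ} {a b c d : ℝ}

lemma hasDerivAt_fst_of_eventuallyEq (hP : DifferentiableAt ℝ P (a, b, c, d))
    (h : uncurryFour p =ᶠ[nhds (a, b, c, d)] P) :
    HasDerivAt (fun x => p x b c d) (fderiv ℝ P (a, b, c, d) (1, 0, 0, 0)) a := by
  have hl : HasDerivAt (fun x : ℝ => (x, b, c, d)) (1, 0, 0, 0) a :=
    (hasDerivAt_id a).prodMk ((hasDerivAt_const a b).prodMk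
      ((hasDerivAt_const a c).prodMk (hasDerivAt_const a d)))
  exact (hP.hasFDerivAt.comp_hasDerivAt a hl).congr_of_eventuallyEq
    (hl.continuousAt.eventually h)

lemma hasDerivAt_snd_of_eventuallyEq (hP : DifferentiableAt ℝ P (a, b, c, d))
    (h : uncurryFour p =ᶠ[nhds (a, b, c, d)] P) :
    HasDerivAt (fun x => p a x c d) (fderiv ℝ P (a, b, c, d) (0, 1, 0, 0)) b := by
  have hl : HasDerivAt (fun x : ℝ => (a, x, c, d)) (0, 1, 0, 0) b :=
    (hasDerivAt_const b a).prodMk ((hasDerivAt_id b).prodMk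
      ((hasDerivAt_const b c).prodMk (hasDerivAt_const b d)))
  exact (hP.hasFDerivAt.comp_hasDerivAt b hl).congr_of_eventuallyEq
    (hl.continuousAt.eventually h)

lemma hasDerivAt_third_of_eventuallyEq (hP : DifferentiableAt ℝ P (a, b, c, d))
    (h : uncurryFour p =ᶠ[nhds (a, b, c, d)] P) :
    HasDerivAt (fun x => p a b x d) (fderiv ℝ P (a, b, c, d) (0, 0, 1, 0)) c := by
  have hl : HasDerivAt (fun x : ℝ => (a, b, x, d)) (0, 0, 1, 0) c :=
    (hasDerivAt_const c a).prodMk ((hasDerivAt_const c b).prodMk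
      ((hasDerivAt_id c).prodMk (hasDerivAt_const c d)))
  exact (hP.hasFDerivAt.comp_hasDerivAt c hl).congr_of_eventuallyEq
    (hl.continuousAt.eventually h)

lemma hasDerivAt_fourth_of_eventuallyEq (hP : DifferentiableAt ℝ P (a, b, c, d))
    (h : uncurryFour p =ᶠ[nhds (a, b, c, d)] P) :
    HasDerivAt (fun x => p a b c x) (fderiv ℝ P (a, b, c, d) (0, 0, 0, 1)) d := by
  have hl : HasDerivAt (fun x : ℝ => (a, b, c, x)) (0, 0, 0, 1) d :=
    (hasDerivAt_const d a).prodMk ((hasDerivAt_const d b).prodMk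
      ((hasDerivAt_const d c).prodMk (hasDerivAt_id d)))
  exact (hP.hasFDerivAt.comp_hasDerivAt d hl).congr_of_eventuallyEq
    (hl.continuousAt.eventually h)

end Partials

lemma differentiableAt_fderiv_apply {F : ℝ × ℝ × ℝ × ℝ → ℝ} {z : ℝ × ℝ × ℝ × ℝ}
    (hF : ContDiffAt ℝ 2 F z) (v : ℝ × ℝ × ℝ × ℝ) :
    DifferentiableAt ℝ (fun y => fderiv ℝ F y v) z :=
  ((hF.fderiv_right (m := 1) (by norm_num)).differentiableAt (by norm_num)).clm_apply
    (differentiableAt_const v)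

lemma fderiv_fderiv_apply_comm {F : ℝ × ℝ × ℝ × ℝ → ℝ} {z : ℝ × ℝ × ℝ × ℝ}
    (hF : ContDiffAt ℝ 2 F z) (u v : ℝ × ℝ × ℝ × ℝ) :
    fderiv ℝ (fun y => fderiv ℝ F y v) z u = fderiv ℝ (fun y => fderiv ℝ F y u) z v := by
  have hd : DifferentiableAt ℝ (fderiv ℝ F) z :=
    (hF.fderiv_right (m := 1) (by norm_num)).differentiableAt (by norm_num)
  have key : ∀ w w', fderiv ℝ (fun y => fderiv ℝ F y w) z w' = fderiv ℝ (fderiv ℝ F) z w' w := by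
    intro w w'
    rw [fderiv_clm_apply hd (differentiableAt_const w)]
    simp
  rw [key, key]
  exact (hF.isSymmSndFDerivAt (by simp)).eq u v

lemma HasDerivAt.const_div_pow {s : ℝ → ℝ} {s' x : ℝ} (hs : HasDerivAt s s' x) (hx : s x ≠ 0)
    (K : ℝ) (n : ℕ) :
    HasDerivAt (fun y => K / s y ^ n) (-(n * K * s') / s x ^ (n + 1)) x := by
  have h1 := ((hs.fun_pow n).fun_inv (pow_ne_zero n hx)).const_mul K
  simp only [← div_eq_mul_inv] at h1
  refine h1.congr_deriv ?_
  rcases n with _ | n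
  · simp
  · simp only [Nat.add_sub_cancel]
    field_simp
    ring

lemma hasDerivAt_div_add_two_mul_pow_left (K : ℝ) (n : ℕ) {a b : ℝ} (h : a + 2 * b ≠ 0) :
    HasDerivAt (fun x => K / (x + 2 * b) ^ n) (-(n * K * 1) / (a + 2 * b) ^ (n + 1)) a :=
  ((hasDerivAt_id a).add_const (2 * b)).const_div_pow h K n

lemma hasDerivAt_div_add_two_mul_pow_right (K : ℝ) (n : ℕ) {a b : ℝ} (h : a + 2 * b ≠ 0) :
    HasDerivAt (fun x => K / (a + 2 * x) ^ n) (-(n * K * (2 * 1)) / (a + 2 * b) ^ (n + 1)) b :=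
  (((hasDerivAt_id b).const_mul 2).const_add a).const_div_pow h K n

lemma aaX_aaDelta_sub {F : ℝ → ℝ → ℝ → ℝ → ℝ} (m k : ℝ) (i : ℕ) (r : ℝ)
    (hF : ContDiffOn ℝ 2 (uncurryFour F) {z : ℝ × ℝ × ℝ × ℝ | z.1 + 2 * z.2.1 ≠ 0})
    {a b c d : ℝ} (h : a + 2 * b ≠ 0) :
    aaX m k i (fun a b c d => r * aaDelta F a b c d) a b c d - r * aaDelta (aaX m k i F) a b c d
      = r * ((3 - i : ℕ) * (m * k ^ 2) / (2 * (a + 2 * b) ^ (3 - i) ) * (a + 2 * b)) *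
        (pdA1 F a b c d + 2 * pdA2 F a b c d) := by
  have hopen : IsOpen {z : ℝ × ℝ × ℝ × ℝ | z.1 + 2 * z.2.1 ≠ 0} :=
    isOpen_ne_fun (by fun_prop) continuous_const
  have hC : ∀ z : ℝ × ℝ × ℝ × ℝ, z.1 + 2 * z.2.1 ≠ 0 → ContDiffAt ℝ 2 (uncurryFour F) z :=
    fun z hz => hF.contDiffAt (hopen.mem_nhds hz)
  have hz := hC (a, b, c, d) h
  have hnhds : ∀ᶠ z in nhds (a, b, c, d), z.1 + 2 * z.2.1 ≠ 0 := hopen.mem_nhds h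
  have e1 : uncurryFour (pdJ1 F) =ᶠ[nhds (a, b, c, d)]
      fun y => fderiv ℝ (uncurryFour F) y (1, 0, 0, 0) := by
    filter_upwards [hnhds] with z hz
    exact (hasDerivAt_fst_of_eventuallyEq ((hC z hz).differentiableAt (by norm_num)) .rfl).deriv
  have e2 : uncurryFour (pdJ2 F) =ᶠ[nhds (a, b, c, d)]
      fun y => fderiv ℝ (uncurryFour F) y (0, 1, 0, 0) := by
    filter_upwards [hnhds] with z hz
    exact (hasDerivAt_snd_of_eventuallyEq ((hC z hz).differentiableAt (by norm_num)) .rfl).deriv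
  have e3 : uncurryFour (pdA1 F) =ᶠ[nhds (a, b, c, d)]
      fun y => fderiv ℝ (uncurryFour F) y (0, 0, 1, 0) := by
    filter_upwards [hnhds] with z hz
    exact (hasDerivAt_third_of_eventuallyEq ((hC z hz).differentiableAt (by norm_num)) .rfl).deriv
  have e4 : uncurryFour (pdA2 F) =ᶠ[nhds (a, b, c, d)]
      fun y => fderiv ℝ (uncurryFour F) y (0, 0, 0, 1) := by
    filter_upwards [hnhds] with z hz
    exact (hasDerivAt_fourth_of_eventuallyEq ((hC z hz).differentiableAt (by norm_num)) .rfl).deriv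
  have D := differentiableAt_fderiv_apply hz
  have hA1 : pdA1 (fun a b c d => r * aaDelta F a b c d) a b c d = _ :=
    ((((hasDerivAt_third_of_eventuallyEq (D _) e1).const_mul ((a ^ 2 + 4 * b ^ 2) / 2)).add
      ((hasDerivAt_third_of_eventuallyEq (D _) e2).const_mul (a * b))).const_mul r).deriv
  have hA2 : pdA2 (fun a b c d => r * aaDelta F a b c d) a b c d = _ :=
    ((((hasDerivAt_fourth_of_eventuallyEq (D _) e1).const_mul ((a ^ 2 + 4 * b ^ 2) / 2)).add
      ((hasDerivAt_fourth_of_eventuallyEq (D _) e2).const_mul (a * b))).const_mul r).deriv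
  have hJ1 : pdJ1 (aaX m k i F) a b c d = _ :=
    ((hasDerivAt_div_add_two_mul_pow_left (m * k ^ 2) (3 - i) h).mul
      ((hasDerivAt_fst_of_eventuallyEq (D _) e3).add
        ((hasDerivAt_fst_of_eventuallyEq (D _) e4).const_mul 2))).deriv
  have hJ2 : pdJ2 (aaX m k i F) a b c d = _ :=
    ((hasDerivAt_div_add_two_mul_pow_right (m * k ^ 2) (3 - i) h).mul
      ((hasDerivAt_snd_of_eventuallyEq (D _) e3).add
        ((hasDerivAt_snd_of_eventuallyEq (D _) e4).const_mul 2))).deriv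
  rw [aaX, hA1, hA2, aaDelta, hJ1, hJ2,
    fderiv_fderiv_apply_comm hz (0, 0, 1, 0) (1, 0, 0, 0),
    fderiv_fderiv_apply_comm hz (0, 0, 1, 0) (0, 1, 0, 0),
    fderiv_fderiv_apply_comm hz (0, 0, 0, 1) (1, 0, 0, 0),
    fderiv_fderiv_apply_comm hz (0, 0, 0, 1) (0, 1, 0, 0)]
  simp only [Pi.add_apply]
  field_simp
  ring

/-- master symmetry relations: (a) for `i ∈ {0,1,2}`, the
commutator of `Xᵢ` with `Δᵢ₊₁ = (2/(3-i))·Δ` equals `X_{i+1}` on twice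
continuously differentiable functions at points with `J₁ + 2J₂ ≠ 0`; and
(b) `Δ(H₀) = mk²/(2(J₁+2J₂))`, which is a first integral of `H₀`:
`{H₀, Δ(H₀)} = 0`. -/
theorem aa_master_symmetry
    (m k : ℝ) (hm : 0 < m) :
    (∀ i : ℕ, i ≤ 2 →
      ∀ f : ℝ → ℝ → ℝ → ℝ → ℝ,
        ContDiffOn ℝ 2 (fun z : ℝ × ℝ × ℝ × ℝ => f z.1 z.2.1 z.2.2.1 z.2.2.2)
          {z : ℝ × ℝ × ℝ × ℝ | z.1 + 2 * z.2.1 ≠ 0} →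
        ∀ J1 J2 φ1 φ2 : ℝ, J1 + 2 * J2 ≠ 0 →
          aaX m k i (fun a b c d => 2 / (3 - (i : ℝ)) * aaDelta f a b c d) J1 J2 φ1 φ2
            - 2 / (3 - (i : ℝ)) * aaDelta (aaX m k i f) J1 J2 φ1 φ2
          = aaX m k (i + 1) f J1 J2 φ1 φ2) ∧
    (∀ J1 J2 φ1 φ2 : ℝ, J1 + 2 * J2 ≠ 0 →
      aaDelta (aaH m k 0) J1 J2 φ1 φ2 = m * k ^ 2 / (2 * (J1 + 2 * J2)) ∧
      aaPB (aaH m k 0) (fun a b _ _ => m * k ^ 2 / (2 * (a + 2 * b))) J1 J2 φ1 φ2 = 0) := by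
  refine ⟨fun i hi f hf a b c d h => ?_, fun a b c d h => ?_⟩
  · rw [aaX_aaDelta_sub m k i _ hf h, aaX]
    congr 1
    interval_cases i <;> norm_num <;> field_simp
  · have h1 : pdJ1 (aaH m k 0) a b c d = m * k ^ 2 / (a + 2 * b) ^ 3 := by
      have := (hasDerivAt_div_add_two_mul_pow_left (-(m * k ^ 2) / 2) 2 h).deriv
      simp only [div_div] at this
      rw [pdJ1]
      simp only [aaH, this]
      push_cast
      field_simp
    have h2 : pdJ2 (aaH m k 0) a b c d = 2 * (m * k ^ 2) / (a + 2 * b) ^ 3 := by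
      have := (hasDerivAt_div_add_two_mul_pow_right (-(m * k ^ 2) / 2) 2 h).deriv
      simp only [div_div] at this
      rw [pdJ2]
      simp only [aaH, this]
      push_cast
      field_simp
    refine ⟨?_, by simp [aaPB, pdA1, pdA2, aaH]⟩
    rw [aaDelta, h1, h2]
    have h' : a + b * 2 ≠ 0 := by rwa [mul_comm b]
    field_simp
    ring
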